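/- The cut rule is admissible in SC_TML: every sequent Γ ⇒ Δ that is derivable in SC_TML (possibly using cut) has a derivation in SC_TML that does not use the cut rule. -/

import Mathlib

/-- Formulas built from propositional variables by the connectives `∧`, `∨`, `¬`, `□`
(no `⊥`). -/
inductive Formula : Type where
  | var : ℕ → Formula
  | and : Formula → Formula → Formula
  | or : Formula → Formula → Formula
  | neg : Formula → Formula
  | box : Formula → Formula
deriving DecidableEq
/-- The two-sided sequent calculus `SC_TML`.  `SCder c Γ Δ` means the sequent `Γ ⇒ Δ`
has a derivation; when `c = false` the cut rule is not allowed (cut-free derivability),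
`SCder true` is plain derivability. -/
inductive SCder : Bool → Finset Formula → Finset Formula → Prop where
  | ax (c : Bool) (α : Formula) : SCder c {α} {α}
  | weakL {c Γ Δ} (α : Formula) : SCder c Γ Δ → SCder c (insert α Γ) Δ
  | weakR {c Γ Δ} (α : Formula) : SCder c Γ Δ → SCder c Γ (insert α Δ)
  | cut {Γ Δ : Finset Formula} {α : Formula} :
      SCder true Γ (insert α Δ) → SCder true (insert α Γ) Δ → SCder true Γ Δ
  | andL {c Γ Δ} (α β : Formula) :
      SCder c (insert α (insert β Γ)) Δ → SCder c (insert (α.and β) Γ) Δ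
  | andR {c Γ Δ} (α β : Formula) :
      SCder c Γ (insert α Δ) → SCder c Γ (insert β Δ) → SCder c Γ (insert (α.and β) Δ)
  | nandL {c Γ Δ} (α β : Formula) :
      SCder c (insert α.neg Γ) Δ → SCder c (insert β.neg Γ) Δ →
      SCder c (insert (α.and β).neg Γ) Δ
  | nandR {c Γ Δ} (α β : Formula) :
      SCder c Γ (insert α.neg (insert β.neg Δ)) → SCder c Γ (insert (α.and β).neg Δ)
  | orL {c Γ Δ} (α β : Formula) :
      SCder c (insert α Γ) Δ → SCder c (insert β Γ) Δ → SCder c (insert (α.or β) Γ) Δ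
  | orR {c Γ Δ} (α β : Formula) :
      SCder c Γ (insert α (insert β Δ)) → SCder c Γ (insert (α.or β) Δ)
  | norL {c Γ Δ} (α β : Formula) :
      SCder c (insert α.neg (insert β.neg Γ)) Δ → SCder c (insert (α.or β).neg Γ) Δ
  | norR {c Γ Δ} (α β : Formula) :
      SCder c Γ (insert α.neg Δ) → SCder c Γ (insert β.neg Δ) →
      SCder c Γ (insert (α.or β).neg Δ)
  | nnL {c Γ Δ} (α : Formula) : SCder c (insert α Γ) Δ → SCder c (insert α.neg.neg Γ) Δ
  | nnR {c Γ Δ} (α : Formula) : SCder c Γ (insert α Δ) → SCder c Γ (insert α.neg.neg Δ)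
  | boxL1 {c Γ Δ} (α : Formula) : SCder c (insert α Γ) Δ → SCder c (insert α.box Γ) Δ
  | boxL2 {c Γ Δ} (α : Formula) : SCder c Γ (insert α.neg Δ) → SCder c (insert α.box Γ) Δ
  | boxR {c Γ Δ} (α : Formula) :
      SCder c Γ (insert α Δ) → SCder c (insert α.neg Γ) Δ → SCder c Γ (insert α.box Δ)
  | nboxL {c Γ Δ} (α : Formula) :
      SCder c Γ (insert α Δ) → SCder c (insert α.neg Γ) Δ → SCder c (insert α.box.neg Γ) Δ
  | nboxR1 {c Γ Δ} (α : Formula) : SCder c (insert α Γ) Δ → SCder c Γ (insert α.box.neg Δ)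
  | nboxR2 {c Γ Δ} (α : Formula) : SCder c Γ (insert α.neg Δ) → SCder c Γ (insert α.box.neg Δ)

namespace Formula

/-- Four-valued semantics: `φ.holds v true` says that `φ` is designated under `v`, and
`φ.holds v false` that its negation is. -/
def holds (v : ℕ → Bool → Prop) : Formula → Bool → Prop
  | var p, b => v p b
  | and α β, true => α.holds v true ∧ β.holds v true
  | and α β, false => α.holds v false ∨ β.holds v false
  | or α β, true => α.holds v true ∨ β.holds v true
  | or α β, false => α.holds v false ∧ β.holds v false
  | neg α, b => α.holds v (!b)
  | box α, true => α.holds v true ∧ ¬ α.holds v false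
  | box α, false => ¬ (α.holds v true ∧ ¬ α.holds v false)

/-- A complexity measure that decreases from the principal formula to the active formulas of
every logical rule. -/
def weight : Formula → ℕ
  | var _ => 1
  | and α β => α.weight + β.weight + 2
  | or α β => α.weight + β.weight + 2
  | neg α => α.weight + 1
  | box α => 2 * α.weight + 2

/-- Propositional variables and their negations. -/
inductive IsLiteral : Formula → Prop
  | var (p : ℕ) : IsLiteral (var p)
  | neg (p : ℕ) : IsLiteral (neg (var p))

end Formula

/-- If `v` makes all of `Γ` designated, it makes a member of `Δ` designated. -/
def SeqHolds (v : ℕ → Bool → Prop) (Γ Δ : Finset Formula) : Prop :=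
  (∀ φ ∈ Γ, φ.holds v true) → ∃ φ ∈ Δ, φ.holds v true

theorem seqHolds_insert_left {v : ℕ → Bool → Prop} {φ : Formula} {Γ Δ : Finset Formula} :
    SeqHolds v (insert φ Γ) Δ ↔ (φ.holds v true → SeqHolds v Γ Δ) := by
  simp [SeqHolds]

theorem seqHolds_insert_right {v : ℕ → Bool → Prop} {φ : Formula} {Γ Δ : Finset Formula} :
    SeqHolds v Γ (insert φ Δ) ↔ (φ.holds v true ∨ SeqHolds v Γ Δ) := by
  simp only [SeqHolds, Finset.exists_mem_insert]
  tauto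

theorem SCder.seqHolds {c : Bool} {Γ Δ : Finset Formula} (h : SCder c Γ Δ)
    (v : ℕ → Bool → Prop) : SeqHolds v Γ Δ := by
  induction h with
  | ax c α => simp [SeqHolds]
  | _ => grind [seqHolds_insert_left, seqHolds_insert_right, Formula.holds]

theorem SCder.mono {c : Bool} {Γ Δ Γ' Δ' : Finset Formula} (h : SCder c Γ Δ) (hΓ : Γ ⊆ Γ')
    (hΔ : Δ ⊆ Δ') : SCder c Γ' Δ' := by
  have left : ∀ s : Finset Formula, SCder c (s ∪ Γ) Δ := by
    intro s
    induction s using Finset.induction_on with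
    | empty => simpa using h
    | insert a s _ ih => rw [Finset.insert_union]; exact ih.weakL a
  have right : ∀ t : Finset Formula, SCder c (Γ' ∪ Γ) (t ∪ Δ) := by
    intro t
    induction t using Finset.induction_on with
    | empty => simpa using left Γ'
    | insert a t _ ih => rw [Finset.insert_union]; exact ih.weakR a
  simpa [Finset.union_eq_left.2 hΓ, Finset.union_eq_left.2 hΔ] using right Δ'

theorem sum_weight_insert_le (φ : Formula) (s : Finset Formula) :
    ∑ ψ ∈ insert φ s, ψ.weight ≤ φ.weight + ∑ ψ ∈ s, ψ.weight := by
  by_cases h : φ ∈ s <;> simp [h]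

theorem exists_common_of_isLiteral {Γ Δ : Finset Formula} (h : ∀ v, SeqHolds v Γ Δ)
    (hΔ : ∀ φ ∈ Δ, φ.IsLiteral) (hΓ : ∀ φ ∈ Γ, φ.IsLiteral) : ∃ φ ∈ Γ, φ ∈ Δ := by
  obtain ⟨φ, hφ, hv⟩ := h (fun p b => if b then .var p ∈ Γ else .neg (.var p) ∈ Γ) (by
    intro φ hφ
    cases hΓ φ hφ <;> simpa [Formula.holds] using hφ)
  refine ⟨φ, ?_, hφ⟩
  cases hΔ φ hφ <;> simpa [Formula.holds] using hv

theorem SCder.of_forall_seqHolds {Γ Δ : Finset Formula} (hv : ∀ v, SeqHolds v Γ Δ) :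
    SCder false Γ Δ := by
  induction hk : ∑ φ ∈ Γ, φ.weight + ∑ φ ∈ Δ, φ.weight using Nat.strong_induction_on
    generalizing Γ Δ with
  | _ k ih =>
  subst hk
  have prove : ∀ {Γ' Δ' : Finset Formula}, ∑ φ ∈ Γ', φ.weight + ∑ φ ∈ Δ', φ.weight <
      ∑ φ ∈ Γ, φ.weight + ∑ φ ∈ Δ, φ.weight ∧
      (∀ v, SeqHolds v Γ Δ → SeqHolds v Γ' Δ') → SCder false Γ' Δ' :=
    fun h => ih _ h.1 (fun v => h.2 v (hv v)) rfl
  clear ih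
  by_cases hΓ : ∀ φ ∈ Γ, φ.IsLiteral
  · by_cases hΔ : ∀ φ ∈ Δ, φ.IsLiteral
    · obtain ⟨φ, h1, h2⟩ := exists_common_of_isLiteral hv hΔ hΓ
      exact (SCder.ax false φ).mono (by simpa using h1) (by simpa using h2)
    · push Not at hΔ
      obtain ⟨φ, hφ, hlit⟩ := hΔ
      obtain ⟨Δ, hn, rfl⟩ : ∃ s, φ ∉ s ∧ insert φ s = Δ :=
        ⟨Δ.erase φ, by simp, Finset.insert_erase hφ⟩
      rw [Finset.sum_insert hn] at prove
      clear hφ hn hΓ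
      rcases φ with p | ⟨α, β⟩ | ⟨α, β⟩ | (p | ⟨α, β⟩ | ⟨α, β⟩ | α | α) | α
      case var => exact (hlit (.var p)).elim
      case neg.var => exact (hlit (.neg p)).elim
      all_goals
        first
        | apply SCder.andR
        | apply SCder.orR
        | apply SCder.nandR
        | apply SCder.norR
        | apply SCder.nnR
        | apply SCder.boxR
        | rw [← Finset.insert_idem]
          apply SCder.nboxR2
          rw [Finset.insert_comm]
          apply SCder.nboxR1
      all_goals
        apply prove
        constructor <;> grind [sum_weight_insert_le, Formula.weight, seqHolds_insert_left,
          seqHolds_insert_right, Formula.holds]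
  · push Not at hΓ
    obtain ⟨φ, hφ, hlit⟩ := hΓ
    obtain ⟨Γ, hn, rfl⟩ : ∃ s, φ ∉ s ∧ insert φ s = Γ :=
      ⟨Γ.erase φ, by simp, Finset.insert_erase hφ⟩
    rw [Finset.sum_insert hn] at prove
    clear hφ hn
    rcases φ with p | ⟨α, β⟩ | ⟨α, β⟩ | (p | ⟨α, β⟩ | ⟨α, β⟩ | α | α) | α
    case var => exact (hlit (.var p)).elim
    case neg.var => exact (hlit (.neg p)).elim
    all_goals
      first
      | apply SCder.andL
      | apply SCder.orL
      | apply SCder.nandL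
      | apply SCder.norL
      | apply SCder.nnL
      | apply SCder.nboxL
      | rw [← Finset.insert_idem]
        apply SCder.boxL1
        rw [Finset.insert_comm]
        apply SCder.boxL2
    all_goals
      apply prove
      constructor <;> grind [sum_weight_insert_le, Formula.weight, seqHolds_insert_left,
        seqHolds_insert_right, Formula.holds]

/-- The cut rule is admissible in `SC_TML`: every derivable sequent is cut-free derivable. -/
theorem sc_cut_admissible (Γ Δ : Finset Formula) :
    SCder true Γ Δ → SCder false Γ Δ := by
  intro h
  exact .of_forall_seqHolds h.seqHolds
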